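/- Let d ≥ 2 and n be positive integers, t ∈ {1, d−1}, and n ≡ t (mod d). Then, as an identity of rational functions in the independent indeterminates b, c, q over ℚ, Σ_{k=0}^{(tn-1)/d} ((q^{1−tn};q^d)_k (q^{1+tn};q^d)_k (q/b;q^d)_k / ((q^d;q^d)_k (c;q^d)_k (q^{d+3}/(bc);q^d)_k)) q^{dk} = (q/b)^{(tn-1)/d} · ((bc/q;q^d)_{(tn-1)/d} (q^{d+2}/c;q^d)_{(tn-1)/d}) / ((c;q^d)_{(tn-1)/d} (q^{d+3}/(bc);q^d)_{(tn-1)/d}). -/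

import Mathlib

open Finset

/-- The `q`-shifted factorial `(x; q)_k = (1-x)(1-xq)⋯(1-xq^{k-1})`. -/
noncomputable def qPoch {K : Type*} [CommRing K] (x q : K) (k : ℕ) : K :=
  ∏ i ∈ Finset.range k, (1 - x * q ^ i)

/-- The polynomial ring `ℚ[b,c,q]` in three independent indeterminates. -/
abbrev R3 : Type := MvPolynomial (Fin 3) ℚ

/-- The fraction field `ℚ(b,c,q)`. -/
abbrev K3 : Type := FractionRing R3

noncomputable def bK : K3 := algebraMap R3 K3 (MvPolynomial.X 0)
noncomputable def cK : K3 := algebraMap R3 K3 (MvPolynomial.X 1)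
noncomputable def qK : K3 := algebraMap R3 K3 (MvPolynomial.X 2)

section

variable {K : Type*}

lemma qPoch_zero [CommRing K] (x p : K) : qPoch x p 0 = 1 := by simp [qPoch]

lemma qPoch_succ [CommRing K] (x p : K) (k : ℕ) :
    qPoch x p (k + 1) = qPoch x p k * (1 - x * p ^ k) := by
  simp [qPoch, prod_range_succ]

lemma qPoch_succ' [CommRing K] (x p : K) (k : ℕ) :
    qPoch x p (k + 1) = (1 - x) * qPoch (x * p) p k := by
  simp [qPoch, prod_range_succ', mul_comm, pow_succ', mul_assoc]

lemma qPoch_ne_zero [Field K] {x p : K} (h : ∀ i : ℕ, 1 - x * p ^ i ≠ 0) (k : ℕ) :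
    qPoch x p k ≠ 0 :=
  prod_ne_zero_iff.2 fun i _ => h i

variable [Field K]

lemma qPoch_inv_pow_self {p : K} (hp : p ≠ 0) (N : ℕ) : qPoch (p ^ N)⁻¹ p (N + 1) = 0 := by
  simp [qPoch_succ, hp]

/-- The `k`-th summand of the balanced terminating `₃φ₂` series with upper parameters
`p⁻ᴺ, A, B` and first lower parameter `C`. -/
noncomputable def saalschutzTerm (A B C p : K) (N k : ℕ) : K :=
  qPoch (p ^ N)⁻¹ p k * qPoch A p k * qPoch B p k /
    (qPoch p p k * qPoch C p k * qPoch (A * B * p / (C * p ^ N)) p k) * p ^ k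

lemma sum_saalschutzTerm_sub {A B C p : K} (hA : A ≠ 0) (hB : B ≠ 0) (hC : C ≠ 0) (hp : p ≠ 0)
    (hp1 : ∀ i : ℕ, 1 - p * p ^ i ≠ 0) (hC1 : ∀ i : ℕ, 1 - C * p ^ i ≠ 0) (N : ℕ)
    (hE1 : ∀ i : ℕ, 1 - A * B / (C * p ^ N) * p ^ i ≠ 0) (m : ℕ) :
    ∑ k ∈ range (m + 1),
        ((1 - C * p ^ N) * (1 - C * p ^ N / (A * B)) * saalschutzTerm A B C p (N + 1) k -
          (1 - C * p ^ N / A) * (1 - C * p ^ N / B) * saalschutzTerm A B C p N k) =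
      (1 - C * p ^ N / (A * B)) *
        (qPoch (p ^ N)⁻¹ p m * qPoch A p (m + 1) * qPoch B p (m + 1) /
          (qPoch p p m * qPoch C p m * qPoch (A * B / (C * p ^ N)) p (m + 1))) := by
  have hy : p ^ N ≠ 0 := pow_ne_zero _ hp
  have hE0 : 1 - A * B / (C * p ^ N) ≠ 0 := by simpa using hE1 0
  have hE : A * B * p / (C * p ^ (N + 1)) = A * B / (C * p ^ N) := by
    rw [pow_succ]
    field_simp
  have hE' : A * B * p / (C * p ^ N) = A * B / (C * p ^ N) * p := by ring
  induction m with
  | zero =>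
    simp only [zero_add, sum_range_one, saalschutzTerm, qPoch_zero, qPoch_succ, pow_zero, mul_one,
      one_mul, div_one]
    generalize p ^ N = y at *
    have h : C * y - A * B ≠ 0 := by
      intro h
      apply hE0
      field_simp
      linear_combination h
    field_simp
    ring
  | succ m ih =>
    rw [sum_range_succ, ih]
    have hEs : qPoch (A * B / (C * p ^ N) * p) p (m + 1) =
        qPoch (A * B / (C * p ^ N)) p (m + 1) * (1 - A * B / (C * p ^ N) * p ^ (m + 1)) /
          (1 - A * B / (C * p ^ N)) := by
      rw [eq_div_iff hE0, ← qPoch_succ, qPoch_succ' _ _ (m + 1), mul_comm]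
    have hNs : qPoch (p ^ (N + 1))⁻¹ p (m + 1) =
        (1 - (p ^ (N + 1))⁻¹) * qPoch (p ^ N)⁻¹ p m := by
      rw [qPoch_succ', pow_succ, mul_inv, inv_mul_cancel_right₀ hp]
    simp only [saalschutzTerm]
    rw [hE, hE', hEs, hNs, qPoch_succ A p (m + 1), qPoch_succ B p (m + 1), qPoch_succ (p ^ N)⁻¹ p m,
      qPoch_succ p p m, qPoch_succ C p m, qPoch_succ (A * B / (C * p ^ N)) p (m + 1)]
    have h1 := qPoch_ne_zero hp1 m
    have h2 := qPoch_ne_zero hC1 m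
    have h3 := qPoch_ne_zero hE1 (m + 1)
    have h4 := hp1 m
    have h5 := hC1 m
    have h6 := hE1 (m + 1)
    generalize qPoch p p m = P at *
    generalize qPoch C p m = Q at *
    generalize qPoch (A * B / (C * p ^ N)) p (m + 1) = R at *
    generalize qPoch A p (m + 1) = S at *
    generalize qPoch B p (m + 1) = T at *
    generalize qPoch (p ^ N)⁻¹ p m = U at *
    rw [pow_succ p N]
    rw [pow_succ p m] at *
    generalize p ^ N = y at *
    generalize p ^ m = z at *
    clear hEs hNs ih hE hE' hp1 hC1 hE1
    obtain ⟨E, hE⟩ : ∃ E, E = A * B / (C * y) := ⟨_, rfl⟩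
    have hEne : E ≠ 0 := by rw [hE]; exact div_ne_zero (mul_ne_zero hA hB) (mul_ne_zero hC hy)
    have hBE : B = E * C * y / A := by rw [hE]; field_simp
    rw [← hE] at hE0 h6 ⊢
    clear hE
    subst hBE
    have hx : 1 - C * y / (E * C * y / A) = 1 - A / E := by field_simp
    have hg : 1 - C * y / (A * (E * C * y / A)) = -(1 - E) / E := by field_simp; ring
    rw [hx, hg]
    have h7 : 1 - E * p * z ≠ 0 := by convert h6 using 2; ring
    field_simp
    ring

/-- The `q`-Pfaff–Saalschütz summation in base `p`. -/
theorem sum_saalschutzTerm {A B C p : K} (hA : A ≠ 0) (hB : B ≠ 0) (hC : C ≠ 0) (hp : p ≠ 0)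
    (hp1 : ∀ i : ℕ, 1 - p * p ^ i ≠ 0) (hC1 : ∀ i : ℕ, 1 - C * p ^ i ≠ 0)
    (hE1 : ∀ N i : ℕ, 1 - A * B / (C * p ^ N) * p ^ i ≠ 0) (N : ℕ) :
    ∑ k ∈ range (N + 1), saalschutzTerm A B C p N k =
      B ^ N * ((qPoch (C / B) p N * qPoch (A * p / (C * p ^ N)) p N) /
        (qPoch C p N * qPoch (A * B * p / (C * p ^ N)) p N)) := by
  induction N with
  | zero => simp [saalschutzTerm, qPoch_zero]
  | succ N ih =>
    have hy : p ^ N ≠ 0 := pow_ne_zero _ hp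
    have hrec := sum_saalschutzTerm_sub hA hB hC hp hp1 hC1 N (hE1 N) (N + 1)
    have hlast : saalschutzTerm A B C p N (N + 1) = 0 := by
      simp [saalschutzTerm, qPoch_inv_pow_self hp]
    rw [qPoch_inv_pow_self hp, sum_sub_distrib, ← mul_sum, ← mul_sum,
      sum_range_succ (saalschutzTerm A B C p N), hlast, ih] at hrec
    simp only [zero_mul, zero_div, mul_zero, add_zero] at hrec
    have hE0 : 1 - A * B / (C * p ^ N) ≠ 0 := by simpa using hE1 N 0
    have hx : 1 - C * p ^ N / (A * B) ≠ 0 := by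
      intro h
      apply hE0
      field_simp at h ⊢
      linear_combination -h
    have h5 := hC1 N
    have h2 := qPoch_ne_zero hC1 N
    have h3 : qPoch (A * B / (C * p ^ N) * p) p N ≠ 0 :=
      qPoch_ne_zero (fun i => by simpa [pow_succ', mul_assoc] using hE1 N (i + 1)) N
    refine mul_left_cancel₀ (mul_ne_zero h5 hx) ((sub_eq_zero.1 hrec).trans ?_)
    have e1 : A * B * p / (C * p ^ (N + 1)) = A * B / (C * p ^ N) := by
      rw [pow_succ]
      field_simp
    have e2 : A * p / (C * p ^ (N + 1)) = A / (C * p ^ N) := by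
      rw [pow_succ]
      field_simp
    have e3 : A * B * p / (C * p ^ N) = A * B / (C * p ^ N) * p := by ring
    have e4 : A * p / (C * p ^ N) = A / (C * p ^ N) * p := by ring
    rw [e1, e2, e3, e4, qPoch_succ' (A * B / (C * p ^ N)), qPoch_succ' (A / (C * p ^ N)),
      qPoch_succ C, qPoch_succ (C / B), pow_succ B]
    generalize qPoch (A * B / (C * p ^ N) * p) p N = P at *
    generalize qPoch (A / (C * p ^ N) * p) p N = Q at *
    generalize qPoch C p N = R at *
    generalize qPoch (C / B) p N = S at *
    generalize p ^ N = y at *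
    have e5 : 1 - C * y / (A * B) = -(C * y / (A * B)) * (1 - A * B / (C * y)) := by
      field_simp
      ring
    rw [e5]
    have e6 : 1 - C * y / A = -(C * y / A) * (1 - A / (C * y)) := by
      field_simp
      ring
    rw [e6]
    generalize hF : 1 - A * B / (C * y) = F at *
    field_simp

end

lemma bK_ne_zero : bK ≠ 0 := by simp [bK]

lemma cK_ne_zero : cK ≠ 0 := by simp [cK]

lemma qK_ne_zero : qK ≠ 0 := by simp [qK]

lemma algebraMap_R3_ne {f g : R3} (v : Fin 3 → ℚ)
    (h : MvPolynomial.eval v f ≠ MvPolynomial.eval v g) :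
    algebraMap R3 K3 f ≠ algebraMap R3 K3 g := fun hfg =>
  h (congrArg _ (IsFractionRing.injective R3 K3 hfg))

lemma one_sub_qK_pow_ne_zero {m : ℕ} (hm : m ≠ 0) : 1 - qK ^ m ≠ 0 := by
  have h := algebraMap_R3_ne (f := 1) (g := MvPolynomial.X 2 ^ m) 0 (by simp [hm])
  simpa [qK, sub_eq_zero] using h

lemma one_sub_cK_mul_qK_pow_ne_zero (m : ℕ) : 1 - cK * qK ^ m ≠ 0 := by
  have h := algebraMap_R3_ne (f := 1) (g := MvPolynomial.X 1 * MvPolynomial.X 2 ^ m) 0 (by simp)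
  simpa [qK, cK, sub_eq_zero] using h

lemma bK_mul_cK_mul_qK_pow_ne (l m : ℕ) : bK * cK * qK ^ l ≠ qK ^ m := by
  have h := algebraMap_R3_ne
    (f := MvPolynomial.X 0 * MvPolynomial.X 1 * MvPolynomial.X 2 ^ l)
    (g := MvPolynomial.X 2 ^ m) ![0, 0, 1] (by simp)
  simpa [qK, cK, bK] using h

lemma dvd_mul_sub_one {d n t : ℕ} (hd : 2 ≤ d) (ht : t = 1 ∨ t = d - 1) (hmod : n % d = t) :
    d ∣ t * n - 1 := by
  obtain ⟨r, rfl⟩ : ∃ r, n = d * r + t := ⟨n / d, by rw [← hmod, Nat.div_add_mod]⟩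
  rcases ht with rfl | rfl
  · simp
  · obtain ⟨e, rfl⟩ : ∃ e, d = e + 2 := ⟨d - 2, by omega⟩
    refine ⟨(e + 1) * r + e, ?_⟩
    simp only [show e + 2 - 1 = e + 1 by omega]
    apply Nat.sub_eq_of_eq_add
    ring

theorem stmt4 (d n t : ℕ) (hd : 2 ≤ d) (hn : 0 < n) (ht : t = 1 ∨ t = d - 1)
    (hmod : n % d = t) :
    ∑ k ∈ Finset.range ((t * n - 1) / d + 1),
        qPoch (qK ^ ((1 : ℤ) - (t * n : ℤ))) (qK ^ d) k *
          qPoch (qK ^ (1 + t * n)) (qK ^ d) k * qPoch (qK / bK) (qK ^ d) k /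
          (qPoch (qK ^ d) (qK ^ d) k * qPoch cK (qK ^ d) k *
            qPoch (qK ^ (d + 3) / (bK * cK)) (qK ^ d) k) * qK ^ (d * k)
      = (qK / bK) ^ ((t * n - 1) / d) *
        ((qPoch (bK * cK / qK) (qK ^ d) ((t * n - 1) / d) *
          qPoch (qK ^ (d + 2) / cK) (qK ^ d) ((t * n - 1) / d)) /
          (qPoch cK (qK ^ d) ((t * n - 1) / d) *
            qPoch (qK ^ (d + 3) / (bK * cK)) (qK ^ d) ((t * n - 1) / d))) := by
  obtain ⟨N, hN⟩ := dvd_mul_sub_one hd ht hmod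
  have htn : 0 < t * n := Nat.mul_pos (by omega) hn
  have hN' : t * n = d * N + 1 := by omega
  have hq := qK_ne_zero
  have hb := bK_ne_zero
  have hc := cK_ne_zero
  have hNd : (t * n - 1) / d = N := by rw [hN, Nat.mul_div_cancel_left _ (by omega)]
  have hz : qK ^ ((1 : ℤ) - (t * n : ℤ)) = ((qK ^ d) ^ N)⁻¹ := by
    rw [← pow_mul, ← zpow_natCast, ← zpow_neg]
    congr 1
    have : (t * n : ℤ) = d * N + 1 := by exact_mod_cast hN'
    push_cast
    rw [this]
    ring
  have hD : qK ^ (1 + t * n) * (qK / bK) * qK ^ d / (cK * (qK ^ d) ^ N) =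
      qK ^ (d + 3) / (bK * cK) := by
    rw [hN']
    field_simp
    ring
  have hC : qK ^ (1 + t * n) * qK ^ d / (cK * (qK ^ d) ^ N) = qK ^ (d + 2) / cK := by
    rw [hN']
    field_simp
    ring
  have hCB : cK / (qK / bK) = bK * cK / qK := by
    field_simp
  have h := sum_saalschutzTerm (A := qK ^ (1 + t * n)) (B := qK / bK) (C := cK) (p := qK ^ d)
    (pow_ne_zero _ hq) (div_ne_zero hq hb) hc (pow_ne_zero _ hq)
    (fun i => by
      rw [← pow_succ', ← pow_mul]
      exact one_sub_qK_pow_ne_zero (by positivity))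
    (fun i => by
      rw [← pow_mul]
      exact one_sub_cK_mul_qK_pow_ne_zero _)
    (fun M i h => bK_mul_cK_mul_qK_pow_ne (d * M) (1 + t * n + 1 + d * i) (by
      rw [← pow_mul, ← pow_mul] at h
      rw [sub_eq_zero] at h
      field_simp at h
      rw [h]
      ring)) N
  simp only [saalschutzTerm, hD, hC, hCB, ← hz] at h
  simp only [hNd, pow_mul]
  exact h
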